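/- (Persistent feasibility with nonlinear constraints.) Suppose A^k → 0 as k → ∞ (equivalently, A is Schur stable), Ω is compact with the origin in its interior, Assumption Q holds, and Q_1 = (1/D_x) I_n with q_1 = 0 for some D_x > 0. Then: (i) for every i ∈ {1,…,p} there exists a finite k_i ∈ ℕ such that for all k ≥ k_i there exists M ∈ cone(𝒬_k ∪ ℋ^l_k) with (Ā^{k+1})ᵀ Q̄_i Ā^{k+1} ⪯ M; (ii) for every i ∈ {1,…,m} there exists a finite k_i ∈ ℕ such that for all k ≥ k_i there exists M ∈ cone(𝒬_k ∪ ℋ^l_k) with (Ā^{k+1})ᵀ H̄_i^u Ā^{k+1} ⪯ M. -/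

import Mathlib

open Matrix

/-- The cone (set of nonnegative linear combinations) generated by a set of matrices. -/
def matCone {α : Type*} [AddCommMonoid α] [Module ℝ α] (S : Set α) : Set α :=
  { M | ∃ (t : Finset α) (c : α → ℝ), (↑t : Set α) ⊆ S ∧ (∀ x ∈ t, 0 ≤ c x) ∧
      M = ∑ x ∈ t, c x • x }

open scoped Matrix.Norms.L2Operator in
/-- A sequence of symmetric matrices tending to zero is eventually dominated by any positive
multiple of the identity. -/
lemma eventually_posSemidef_smul_one_sub {ι : Type*} [Fintype ι] [DecidableEq ι]
    {E : ℕ → Matrix ι ι ℝ} (hE : Filter.Tendsto E Filter.atTop (nhds 0))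
    (hsymm : ∀ k, (E k).IsHermitian) {δ : ℝ} (hδ : 0 < δ) :
    ∀ᶠ k in Filter.atTop, (δ • (1 : Matrix ι ι ℝ) - E k).PosSemidef := by
  have hnorm := hE.norm
  rw [norm_zero] at hnorm
  filter_upwards [hnorm.eventually_lt_const hδ] with k hk
  refine Matrix.PosSemidef.of_dotProduct_mulVec_nonneg
    ((Matrix.isHermitian_one.smul (IsSelfAdjoint.all δ)).sub (hsymm k)) fun z => ?_
  set w : EuclideanSpace ℝ ι := WithLp.toLp 2 z
  have hle : z ⬝ᵥ E k *ᵥ z ≤ ‖w‖ * (‖E k‖ * ‖w‖) :=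
    calc z ⬝ᵥ E k *ᵥ z = inner ℝ w (WithLp.toLp 2 (E k *ᵥ z)) := by
          rw [EuclideanSpace.inner_toLp_toLp, star_trivial, dotProduct_comm]
      _ ≤ ‖w‖ * ‖WithLp.toLp 2 (E k *ᵥ z)‖ := real_inner_le_norm _ _
      _ ≤ ‖w‖ * (‖E k‖ * ‖w‖) := by
          gcongr
          exact Matrix.l2_opNorm_mulVec (E k) w
  have hsq : z ⬝ᵥ z = ‖w‖ ^ 2 := by
    rw [← real_inner_self_eq_norm_sq, EuclideanSpace.inner_toLp_toLp, star_trivial]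
  rw [star_trivial, Matrix.sub_mulVec, dotProduct_sub, Matrix.smul_mulVec, Matrix.one_mulVec,
    dotProduct_smul, hsq, smul_eq_mul]
  nlinarith [mul_le_mul_of_nonneg_right hk.le (sq_nonneg ‖w‖)]

/-- Powers of `diag(A, 1)` converge to `diag(0, 1)` when the powers of `A` converge to zero. -/
lemma tendsto_fromBlocks_one_pow {n : ℕ} {A : Matrix (Fin n) (Fin n) ℝ}
    (hA : Filter.Tendsto (fun k : ℕ => A ^ k) Filter.atTop (nhds 0)) :
    Filter.Tendsto (fun k : ℕ => (Matrix.fromBlocks A 0 0 (1 : Matrix Unit Unit ℝ)) ^ k)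
      Filter.atTop (nhds (Matrix.fromBlocks 0 0 0 1)) := by
  simp only [Matrix.fromBlocks_diagonal_pow, one_pow]
  have hc : Continuous fun X : Matrix (Fin n) (Fin n) ℝ =>
      Matrix.fromBlocks X 0 0 (1 : Matrix Unit Unit ℝ) :=
    continuous_id.matrix_fromBlocks continuous_const continuous_const continuous_const
  exact (hc.tendsto 0).comp hA

/-- If the powers of `A` tend to zero, then conjugating a symmetric matrix with lower right
entry `-1` by high powers of `diag(A, 1)` gives a matrix dominated by half of `diag(c I, -1)`. -/
lemma eventually_posSemidef_half_sub_conj {n : ℕ} {A : Matrix (Fin n) (Fin n) ℝ}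
    (hA : Filter.Tendsto (fun k : ℕ => A ^ k) Filter.atTop (nhds 0)) {c : ℝ} (hc : 0 < c)
    {P : Matrix (Fin n) (Fin n) ℝ} (hP : Pᵀ = P) (v : Fin n → ℝ) :
    ∀ᶠ k in Filter.atTop,
      ((1 / 2 : ℝ) • Matrix.fromBlocks (c • (1 : Matrix (Fin n) (Fin n) ℝ)) 0 0
          (Matrix.of fun (_ : Unit) (_ : Unit) => (-1 : ℝ)) -
        ((Matrix.fromBlocks A 0 0 (1 : Matrix Unit Unit ℝ)) ^ (k + 1))ᵀ *
          Matrix.fromBlocks P (Matrix.of fun r (_ : Unit) => v r)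
            (Matrix.of fun (_ : Unit) s => v s)
            (Matrix.of fun (_ : Unit) (_ : Unit) => (-1 : ℝ)) *
          (Matrix.fromBlocks A 0 0 (1 : Matrix Unit Unit ℝ)) ^ (k + 1)).PosSemidef := by
  set B : Matrix (Fin n ⊕ Unit) (Fin n ⊕ Unit) ℝ := Matrix.fromBlocks A 0 0 1
  set N : Matrix (Fin n ⊕ Unit) (Fin n ⊕ Unit) ℝ :=
    Matrix.fromBlocks P (Matrix.of fun r (_ : Unit) => v r) (Matrix.of fun (_ : Unit) s => v s)
      (Matrix.of fun (_ : Unit) (_ : Unit) => (-1 : ℝ)) with hN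
  set J : Matrix (Fin n ⊕ Unit) (Fin n ⊕ Unit) ℝ := Matrix.fromBlocks 0 0 0 1 with hJ
  have hNsymm : Nᵀ = N := by
    rw [hN, Matrix.fromBlocks_transpose, hP]
    rfl
  have hJsymm : Jᵀ = J := by simp [hJ, Matrix.fromBlocks_transpose]
  have hJNJ : Jᵀ * N * J + J = 0 := by
    rw [hJsymm, hJ, hN, Matrix.fromBlocks_multiply, Matrix.fromBlocks_multiply,
      Matrix.fromBlocks_add]
    ext (i | i) (j | j) <;> simp
  have hlim : Filter.Tendsto (fun k : ℕ => (B ^ (k + 1))ᵀ * N * B ^ (k + 1) + J)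
      Filter.atTop (nhds 0) := by
    have hcont : Continuous fun X : Matrix (Fin n ⊕ Unit) (Fin n ⊕ Unit) ℝ => Xᵀ * N * X + J := by
      fun_prop
    have h := (hcont.tendsto J).comp
      ((tendsto_fromBlocks_one_pow hA).comp (Filter.tendsto_add_atTop_nat 1))
    rw [hJNJ] at h
    exact h
  have hherm : ∀ k : ℕ, ((B ^ (k + 1))ᵀ * N * B ^ (k + 1) + J).IsHermitian := fun k => by
    rw [Matrix.IsHermitian, Matrix.conjTranspose_eq_transpose_of_trivial]
    simp only [Matrix.transpose_add, Matrix.transpose_mul, Matrix.transpose_transpose, hNsymm,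
      hJsymm, Matrix.mul_assoc]
  have hδ : 0 < min (c / 2) (1 / 2) := by positivity
  filter_upwards [eventually_posSemidef_smul_one_sub hlim hherm hδ] with k hk
  have hdiag : (Matrix.diagonal (Sum.elim (fun _ : Fin n => c / 2 - min (c / 2) (1 / 2))
      (fun _ : Unit => 1 / 2 - min (c / 2) (1 / 2)))).PosSemidef := by
    refine Matrix.PosSemidef.diagonal ?_
    rintro (i | i)
    · simp
    · simp
  convert hdiag.add hk using 1
  rw [← add_sub_assoc, add_comm _ J, ← sub_sub]
  congr 1
  ext (i | i) (j | j)
  · by_cases hij : i = j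
    · simp [hJ, hij]
      ring
    · simp [hJ, hij]
  · simp [hJ]
  · simp [hJ]
  · simp [hJ]
    ring

lemma smul_mem_matCone {α : Type*} [AddCommMonoid α] [Module ℝ α] {S : Set α} {x : α}
    (hx : x ∈ S) {c : ℝ} (hc : 0 ≤ c) : c • x ∈ matCone S :=
  ⟨{x}, fun _ => c, by simpa using hx, fun _ _ => hc, by simp⟩

/-- Persistent feasibility with nonlinear constraints: under Schur stability of A,
compactness of Ω with 0 in its interior, quasi-smoothness of the H_i, and the
redundant ball constraint Q_1 = (1/D_x)I, q_1 = 0, for each i there is a finite k_i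
such that for all k ≥ k_i the matrices (Ā^{k+1})ᵀ Q̄_i Ā^{k+1} resp.
(Ā^{k+1})ᵀ H̄_i^u Ā^{k+1} are dominated by elements of cone(𝒬_k ∪ ℋ^l_k). -/
theorem persistent_feasibility_nonlinear (n p m : ℕ) (hp : 0 < p)
    (A : Matrix (Fin n) (Fin n) ℝ)
    (hA : Filter.Tendsto (fun k : ℕ => A ^ k) Filter.atTop (nhds 0))
    (Q : Fin p → Matrix (Fin n) (Fin n) ℝ) (q : Fin p → Fin n → ℝ)
    (hQsymm : ∀ i, (Q i)ᵀ = Q i)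
    (Ω : Set (Fin n → ℝ))
    (hΩ : Ω = {x : Fin n → ℝ | ∀ i : Fin p, x ⬝ᵥ (Q i).mulVec x + 2 * (q i ⬝ᵥ x) ≤ 1})
    (hΩcompact : IsCompact Ω) (hΩint : (0 : Fin n → ℝ) ∈ interior Ω)
    (Dx : ℝ) (hDx : 0 < Dx)
    (hQ1 : Q ⟨0, hp⟩ = (1 / Dx) • (1 : Matrix (Fin n) (Fin n) ℝ))
    (hq1 : q ⟨0, hp⟩ = 0)
    (H : Fin m → (Fin n → ℝ) → ℝ)
    (hHcont : ∀ i, Continuous (H i)) (hH0 : ∀ i, H i 0 = 0)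
    (G : Fin m → Fin n → ℝ) (L : Fin m → ℝ) (hL : ∀ i, 0 ≤ L i)
    (hquasi : ∀ i : Fin m, ∀ x ∈ Ω, |H i x - H i 0 - G i ⬝ᵥ x| ≤ L i / 2 * (x ⬝ᵥ x))
    (Abar : Matrix (Fin n ⊕ Unit) (Fin n ⊕ Unit) ℝ)
    (hAbar : Abar = Matrix.fromBlocks A 0 0 1)
    (Qbar : Fin p → Matrix (Fin n ⊕ Unit) (Fin n ⊕ Unit) ℝ)
    (hQbar : ∀ i, Qbar i = Matrix.fromBlocks (Q i) (Matrix.of fun r (_ : Unit) => q i r)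
      (Matrix.of fun (_ : Unit) c => q i c) (Matrix.of fun (_ : Unit) (_ : Unit) => (-1 : ℝ)))
    (Hubar : Fin m → Matrix (Fin n ⊕ Unit) (Fin n ⊕ Unit) ℝ)
    (hHubar : ∀ i, Hubar i = Matrix.fromBlocks ((L i / 2) • (1 : Matrix (Fin n) (Fin n) ℝ))
      (Matrix.of fun r (_ : Unit) => G i r / 2)
      (Matrix.of fun (_ : Unit) c => G i c / 2)
      (Matrix.of fun (_ : Unit) (_ : Unit) => H i 0 - 1))
    (Hlbar : Fin m → Matrix (Fin n ⊕ Unit) (Fin n ⊕ Unit) ℝ)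
    (hHlbar : ∀ i, Hlbar i = Matrix.fromBlocks (-(L i / 2) • (1 : Matrix (Fin n) (Fin n) ℝ))
      (Matrix.of fun r (_ : Unit) => G i r / 2)
      (Matrix.of fun (_ : Unit) c => G i c / 2)
      (Matrix.of fun (_ : Unit) (_ : Unit) => H i 0 - 1))
    (𝒬 : ℕ → Set (Matrix (Fin n ⊕ Unit) (Fin n ⊕ Unit) ℝ))
    (h𝒬0 : 𝒬 0 = Set.range Qbar)
    (h𝒬succ : ∀ k : ℕ, 𝒬 (k + 1) = 𝒬 k ∪ (fun M => Abarᵀ * M * Abar) '' 𝒬 k)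
    (ℋl : ℕ → Set (Matrix (Fin n ⊕ Unit) (Fin n ⊕ Unit) ℝ))
    (hℋl0 : ℋl 0 = Set.range Hlbar)
    (hℋlsucc : ∀ k : ℕ, ℋl (k + 1) = ℋl k ∪ (fun M => Abarᵀ * M * Abar) '' ℋl k) :
    (∀ i : Fin p, ∃ ki : ℕ, ∀ k : ℕ, ki ≤ k → ∃ M ∈ matCone (𝒬 k ∪ ℋl k),
      (M - (Abar ^ (k + 1))ᵀ * Qbar i * Abar ^ (k + 1)).PosSemidef) ∧
    (∀ i : Fin m, ∃ ki : ℕ, ∀ k : ℕ, ki ≤ k → ∃ M ∈ matCone (𝒬 k ∪ ℋl k),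
      (M - (Abar ^ (k + 1))ᵀ * Hubar i * Abar ^ (k + 1)).PosSemidef) := by
  have hQmem : ∀ k, Qbar ⟨0, hp⟩ ∈ 𝒬 k := fun k => by
    induction k with
    | zero => exact h𝒬0 ▸ Set.mem_range_self _
    | succ k ih => exact h𝒬succ k ▸ Or.inl ih
  have hQbar1 : Qbar ⟨0, hp⟩ = Matrix.fromBlocks ((1 / Dx) • (1 : Matrix (Fin n) (Fin n) ℝ)) 0 0
      (Matrix.of fun (_ : Unit) (_ : Unit) => (-1 : ℝ)) := by
    rw [hQbar, hQ1, hq1]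
    rfl
  have hc : 0 < 1 / Dx := by positivity
  have hmem : ∀ k, (1 / 2 : ℝ) • Qbar ⟨0, hp⟩ ∈ matCone (𝒬 k ∪ ℋl k) := fun k =>
    smul_mem_matCone (Set.mem_union_left _ (hQmem k)) (by norm_num)
  refine ⟨fun i => ?_, fun i => ?_⟩
  · obtain ⟨ki, hki⟩ := Filter.eventually_atTop.mp
      (eventually_posSemidef_half_sub_conj hA hc (hQsymm i) (q i))
    refine ⟨ki, fun k hk => ⟨_, hmem k, ?_⟩⟩
    rw [hQbar1, hQbar i, hAbar]
    exact hki k hk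
  · have hsymm : ((L i / 2) • (1 : Matrix (Fin n) (Fin n) ℝ))ᵀ = (L i / 2) • 1 := by simp
    obtain ⟨ki, hki⟩ := Filter.eventually_atTop.mp
      (eventually_posSemidef_half_sub_conj hA hc hsymm (fun r => G i r / 2))
    refine ⟨ki, fun k hk => ⟨_, hmem k, ?_⟩⟩
    rw [hQbar1, hHubar i, hAbar, hH0 i, zero_sub]
    exact hki k hk
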